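/- The Artin group A_{333} contains a normal subgroup N isomorphic to the free group of rank 7 such that the quotient A_{333}/N is isomorphic to the free product (ℤ/3ℤ) * (ℤ/2ℤ). Consequently, A_{333} is residually finite. -/

import Mathlib

/-- The alternating word (a,b)_M = abab⋯ of length M in the free group. -/
def altWord {V : Type} (a b : V) (M : ℕ) : FreeGroup V :=
  ((List.range M).map fun i => if i % 2 = 0 then FreeGroup.of a else FreeGroup.of b).prod

/-- The relators of the Artin group A_{MNP} on three generators a = 0, b = 1, c = 2. -/
def artinRels3 (M N P : ℕ) : Set (FreeGroup (Fin 3)) :=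
  {altWord 0 1 M * (altWord 1 0 M)⁻¹,
   altWord 1 2 N * (altWord 2 1 N)⁻¹,
   altWord 2 0 P * (altWord 0 2 P)⁻¹}

/-- The Artin group A_{MNP}. -/
abbrev Artin3 (M N P : ℕ) : Type := PresentedGroup (artinRels3 M N P)

/-- A group is residually finite if every nontrivial element survives in some finite quotient. -/
def ResiduallyFinite (G : Type*) [Group G] : Prop :=
  ∀ g : G, g ≠ 1 → ∃ (Q : Type) (_ : Group Q) (_ : Finite Q) (φ : G →* Q), φ g ≠ 1

namespace Artin333

/-! ### Amalgamation -/

/-- A family of two types. -/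
def Fam (A B : Type) : Bool → Type
  | false => A
  | true => B

instance famGroup (A B : Type) [Group A] [Group B] : ∀ b, Group (Fam A B b)
  | false => inferInstanceAs (Group A)
  | true => inferInstanceAs (Group B)

/-- A family of two homomorphisms. -/
def famHom {H A B : Type} [Group H] [Group A] [Group B] (f : H →* A) (g : H →* B) :
    ∀ b, H →* Fam A B b
  | false => f
  | true => g

theorem exists_amalgam {H A B : Type} [Group H] [Group A] [Group B] (f : H →* A) (g : H →* B)
    (hf : Function.Injective f) (hg : Function.Injective g) :
    ∃ (P : Type) (_ : Group P) (iA : A →* P) (iB : B →* P),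
      (∀ h, iA (f h) = iB (g h)) ∧ Function.Injective (fun h => iA (f h)) := by
  let φ := famHom f g
  have hφ : ∀ b, Function.Injective (φ b) := by
    intro b
    cases b
    · exact hf
    · exact hg
  refine ⟨Monoid.PushoutI φ, inferInstance, Monoid.PushoutI.of (φ := φ) false,
    Monoid.PushoutI.of (φ := φ) true, ?_, ?_⟩
  · intro h
    exact (Monoid.PushoutI.of_apply_eq_base φ false h).trans
      (Monoid.PushoutI.of_apply_eq_base φ true h).symm
  · have h1 := Monoid.PushoutI.base_injective hφ
    intro x y hxy
    apply h1
    rw [← Monoid.PushoutI.of_apply_eq_base φ false x, ← Monoid.PushoutI.of_apply_eq_base φ false y]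
    exact hxy

/-! ### The two embeddings of the free group of rank 7 -/

/-- A criterion for injectivity through an action by permutations. -/
theorem injective_of_perm {α β ι : Type} (w : α → FreeGroup β) (i₀ : ι)
    (act : FreeGroup β →* Equiv.Perm (ι × FreeGroup α))
    (hw : ∀ a h, act (w a) (i₀, h) = (i₀, FreeGroup.of a * h)) :
    Function.Injective (FreeGroup.lift w) := by
  have key : ∀ g h, act (FreeGroup.lift w g) (i₀, h) = (i₀, g * h) := by
    intro g
    induction g using FreeGroup.induction_on with
    | C1 => intro h; simp
    | of a => intro h; simpa using hw a h
    | inv_of a ih =>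
      intro h
      rw [map_inv, map_inv, Equiv.Perm.inv_eq_iff_eq, ih]
      simp
    | mul x y hx hy =>
      intro h
      rw [map_mul, map_mul, Equiv.Perm.mul_apply, hy, hx, mul_assoc]
  rw [injective_iff_map_eq_one]
  intro g hg
  have := key g 1
  rw [hg] at this
  simpa using this.symm

/-- The seven words in `x, y, z` (and their amalgamated counterparts). -/
def w3 {H : Type*} [Group H] (x y z : H) : Fin 7 → H :=
  ![x * x * x, y * x⁻¹, z * x⁻¹, x * y * x⁻¹ * x⁻¹, x * z * x⁻¹ * x⁻¹, x * x * y, x * x * z]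

/-- The seven words in `t, p, q, r`. -/
def w4 {H : Type*} [Group H] (t p q r : H) : Fin 7 → H :=
  ![t * t, p, q, r, t * q * p⁻¹ * t⁻¹, t * p * r * t, t * p * t]

open FreeGroup in
theorem inj3 : Function.Injective
    (FreeGroup.lift (w3 (of (0 : Fin 3)) (of 1) (of 2)) : FreeGroup (Fin 7) →* _) := by
  let σ : Equiv.Perm (Fin 3) := finRotate 3
  let k : FreeGroup (Fin 7) := of 0
  let X : Equiv.Perm (Fin 3 × FreeGroup (Fin 7)) :=
    Equiv.prodShear σ (fun i => Equiv.mulLeft (![1, 1, k] i))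
  let Y : Equiv.Perm (Fin 3 × FreeGroup (Fin 7)) :=
    Equiv.prodShear σ (fun i => Equiv.mulLeft (![k⁻¹ * of 5, k⁻¹ * of 3 * k, of 1 * k] i))
  let Z : Equiv.Perm (Fin 3 × FreeGroup (Fin 7)) :=
    Equiv.prodShear σ (fun i => Equiv.mulLeft (![k⁻¹ * of 6, k⁻¹ * of 4 * k, of 2 * k] i))
  have X0 : ∀ h, X (0, h) = (1, h) := fun h => by simp [X, σ]
  have X1 : ∀ h, X (1, h) = (2, h) := fun h => by simp [X, σ]
  have X2 : ∀ h, X (2, h) = (0, k * h) := fun h => by simp [X, σ]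
  have X0' : ∀ h, X.symm (0, h) = (2, k⁻¹ * h) := fun h => by
    rw [Equiv.symm_apply_eq, X2]; simp
  have X1' : ∀ h, X.symm (1, h) = (0, h) := fun h => by rw [Equiv.symm_apply_eq, X0]
  have X2' : ∀ h, X.symm (2, h) = (1, h) := fun h => by rw [Equiv.symm_apply_eq, X1]
  have Y0 : ∀ h, Y (0, h) = (1, k⁻¹ * of 5 * h) := fun h => by simp [Y, σ, mul_assoc]
  have Y1 : ∀ h, Y (1, h) = (2, k⁻¹ * of 3 * k * h) := fun h => by simp [Y, σ, mul_assoc]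
  have Y2 : ∀ h, Y (2, h) = (0, of 1 * k * h) := fun h => by simp [Y, σ, mul_assoc]
  have Z0 : ∀ h, Z (0, h) = (1, k⁻¹ * of 6 * h) := fun h => by simp [Z, σ, mul_assoc]
  have Z1 : ∀ h, Z (1, h) = (2, k⁻¹ * of 4 * k * h) := fun h => by simp [Z, σ, mul_assoc]
  have Z2 : ∀ h, Z (2, h) = (0, of 2 * k * h) := fun h => by simp [Z, σ, mul_assoc]
  refine injective_of_perm _ (0 : Fin 3) (FreeGroup.lift ![X, Y, Z]) ?_
  intro a h
  fin_cases a <;>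
    simp [w3, X0, X1, X2, X0', X1', X2', Y0, Y1, Y2, Z0, Z1, Z2, mul_assoc, k]

open FreeGroup in
theorem inj4 : Function.Injective
    (FreeGroup.lift (w4 (of (0 : Fin 4)) (of 1) (of 2) (of 3)) : FreeGroup (Fin 7) →* _) := by
  let k : FreeGroup (Fin 7) := of 0
  let σ : Equiv.Perm (Fin 2) := finRotate 2
  let T : Equiv.Perm (Fin 2 × FreeGroup (Fin 7)) :=
    Equiv.prodShear σ (fun i => Equiv.mulLeft (![1, k] i))
  let D : FreeGroup (Fin 7) → FreeGroup (Fin 7) → Equiv.Perm (Fin 2 × FreeGroup (Fin 7)) :=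
    fun u v => Equiv.prodShear (Equiv.refl _) (fun i => Equiv.mulLeft (![u, v] i))
  have T0 : ∀ h, T (0, h) = (1, h) := fun h => by simp [T, σ]
  have T1 : ∀ h, T (1, h) = (0, k * h) := fun h => by simp [T, σ]
  have T0' : ∀ h, T.symm (0, h) = (1, k⁻¹ * h) := fun h => by
    rw [Equiv.symm_apply_eq, T1]; simp
  have D0 : ∀ u v h, D u v (0, h) = (0, u * h) := fun u v h => by simp [D]
  have D1 : ∀ u v h, D u v (1, h) = (1, v * h) := fun u v h => by simp [D]
  have D1' : ∀ u v h, (D u v).symm (1, h) = (1, v⁻¹ * h) := fun u v h => by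
    rw [Equiv.symm_apply_eq, D1]; simp
  refine injective_of_perm _ (0 : Fin 2) (FreeGroup.lift ![T, D (of 1) (k⁻¹ * of 6),
    D (of 2) (k⁻¹ * of 4 * of 6), D (of 3) ((of 6)⁻¹ * of 5)]) ?_
  intro a h
  fin_cases a <;>
    simp [w4, T0, T1, T0', D0, D1, D1', mul_assoc, k]

/-! ### Word computations -/

section words
variable {H : Type*} [Group H]

/-- The relations between `x, y, z, t`. -/
structure Rels (x y z t : H) : Prop where
  r1 : t * t = x * x * x
  r2 : x * x * z = t * y * x⁻¹ * t
  r3 : x * x * y = t * y * y * x⁻¹ * x⁻¹ * t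
  r4 : x * z * x⁻¹ * x⁻¹ = t * z * y⁻¹ * t⁻¹

theorem rels_of_braid {a b c : H} (h1 : a * b * a = b * a * b) (h2 : b * c * b = c * b * c)
    (h3 : c * a * c = a * c * a) : Rels (a * b) (b * c) (c * a) (a * b * a) := by
  refine ⟨?_, ?_, ?_, ?_⟩
  · calc a * b * a * (a * b * a) = a * b * a * (b * a * b) := by rw [h1]
      _ = _ := by group
  · group
  · calc a * b * (a * b) * (b * c) = a * b * a * b * (b * c * b) * b⁻¹ := by group
      _ = a * b * a * b * (c * b * c) * b⁻¹ := by rw [h2]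
      _ = _ := by group
  · calc a * b * (c * a) * (a * b)⁻¹ * (a * b)⁻¹ 
          = a * b * (c * a * c) * c⁻¹ * (a * b)⁻¹ * (a * b)⁻¹ := by group
      _ = a * b * (a * c * a) * c⁻¹ * b⁻¹ * (a * b * a)⁻¹ := by rw [h3]; group
      _ = _ := by group

variable {x y z t : H}

theorem Rels.braid1 (h : Rels x y z t) :
    (x⁻¹ * t) * (t⁻¹ * x * x) * (x⁻¹ * t) = (t⁻¹ * x * x) * (x⁻¹ * t) * (t⁻¹ * x * x) := by
  calc _ = t⁻¹ * (t * t) := by group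
    _ = t⁻¹ * (x * x * x) := by rw [h.r1]
    _ = _ := by group

theorem Rels.braid2 (h : Rels x y z t) :
    (t⁻¹ * x * x) * (x⁻¹ * x⁻¹ * t * y) * (t⁻¹ * x * x) =
      (x⁻¹ * x⁻¹ * t * y) * (t⁻¹ * x * x) * (x⁻¹ * x⁻¹ * t * y) := by
  calc _ = x⁻¹ * x⁻¹ * (x * x * y) * t⁻¹ * x * x := by group
    _ = x⁻¹ * x⁻¹ * (t * y * y * x⁻¹ * x⁻¹ * t) * t⁻¹ * x * x := by rw [h.r3]
    _ = _ := by group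

theorem Rels.z_eq (h : Rels x y z t) : (x⁻¹ * x⁻¹ * t * y) * (x⁻¹ * t) = z := by
  calc _ = x⁻¹ * x⁻¹ * (t * y * x⁻¹ * t) := by group
    _ = x⁻¹ * x⁻¹ * (x * x * z) := by rw [h.r2]
    _ = _ := by group

theorem Rels.braid3 (h : Rels x y z t) :
    (x⁻¹ * x⁻¹ * t * y) * (x⁻¹ * t) * (x⁻¹ * x⁻¹ * t * y) =
      (x⁻¹ * t) * (x⁻¹ * x⁻¹ * t * y) * (x⁻¹ * t) := by
  rw [mul_assoc (x⁻¹ * t), h.z_eq]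
  calc _ = x⁻¹ * (x * z * x⁻¹ * x⁻¹) * t * y := by group
    _ = x⁻¹ * (t * z * y⁻¹ * t⁻¹) * t * y := by rw [h.r4]
    _ = _ := by group

/-- The amalgamated words agree. -/
theorem Rels.of_eq {p q r : H} (h : ∀ i, w3 x y z i = w4 t p q r i) : Rels x y z t := by
  have h0 := h 0
  have h1 := h 1
  have h2 := h 2
  have h3 := h 3
  have h4 := h 4
  have h5 := h 5
  have h6 := h 6
  simp [w3, w4] at h0 h1 h2 h3 h4 h5 h6
  refine ⟨h0.symm, ?_, ?_, ?_⟩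
  · rw [h6, ← h1]; group
  · rw [h5, ← h1, ← h3]; group
  · rw [h4, ← h1, ← h2]; group

theorem conj_x (x y z : H) (i : Fin 7) :
    x * w3 x y z i * x⁻¹ ∈ Subgroup.closure (Set.range (w3 x y z)) := by
  have m : ∀ j, w3 x y z j ∈ Subgroup.closure (Set.range (w3 x y z)) :=
    fun j => Subgroup.subset_closure ⟨j, rfl⟩
  fin_cases i
  · convert m 0 using 1; simp [w3]; try group
  · convert m 3 using 1; simp [w3]; try group
  · convert m 4 using 1; simp [w3]; try group
  · convert mul_mem (m 5) (inv_mem (m 0)) using 1; simp [w3]; try group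
  · convert mul_mem (m 6) (inv_mem (m 0)) using 1; simp [w3]; try group
  · convert mul_mem (m 0) (m 1) using 1; simp [w3]; try group
  · convert mul_mem (m 0) (m 2) using 1; simp [w3]; try group

theorem Rels.conj_t (h : Rels x y z t) (i : Fin 7) :
    t * w3 x y z i * t⁻¹ ∈ Subgroup.closure (Set.range (w3 x y z)) := by
  have m : ∀ j, w3 x y z j ∈ Subgroup.closure (Set.range (w3 x y z)) :=
    fun j => Subgroup.subset_closure ⟨j, rfl⟩
  have e0 : w3 x y z 0 = t * t := by simp [w3, h.r1]
  have e1 : w3 x y z 1 = y * x⁻¹ := rfl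
  have e2 : w3 x y z 2 = z * x⁻¹ := rfl
  have e3 : w3 x y z 3 = x * y * x⁻¹ * x⁻¹ := rfl
  have e4 : w3 x y z 4 = t * z * y⁻¹ * t⁻¹ := h.r4
  have e5 : w3 x y z 5 = t * y * y * x⁻¹ * x⁻¹ * t := h.r3
  have e6 : w3 x y z 6 = t * y * x⁻¹ * t := h.r2
  fin_cases i
  · convert m 0 using 1; simp only [Fin.reduceFinMk, Fin.zero_eta, e0]; group
  · convert mul_mem (m 6) (inv_mem (m 0)) using 1
    simp only [Fin.reduceFinMk, Fin.mk_one, e0, e1, e6]; group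
  · convert mul_mem (m 4) (mul_mem (m 6) (inv_mem (m 0))) using 1
    simp only [Fin.reduceFinMk, e0, e2, e4, e6]; group
  · convert mul_mem (inv_mem (mul_mem (m 6) (inv_mem (m 0)))) (mul_mem (m 5) (inv_mem (m 0)))
      using 1
    simp only [Fin.reduceFinMk, e0, e3, e5, e6]; group
  · convert mul_mem (m 0) (mul_mem (mul_mem (m 2) (inv_mem (m 1))) (inv_mem (m 0))) using 1
    simp only [Fin.reduceFinMk, e0, e1, e2, e4]; group
  · convert mul_mem (m 0) (mul_mem (m 1) (m 3)) using 1
    simp only [Fin.reduceFinMk, e0, e1, e3, e5]; group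
  · convert mul_mem (m 0) (m 1) using 1
    simp only [Fin.reduceFinMk, e0, e1, e6]; group

/-- If `g³` or `g²` lies in a subgroup and `g` conjugates generators into it, then `g` normalizes. -/
theorem mem_normalizer_of {S : Set H} {g : H} (hS : ∀ s ∈ S, g * s * g⁻¹ ∈ Subgroup.closure S)
    {n : ℕ} (hg : g ^ (n + 1) ∈ Subgroup.closure S) :
    g ∈ Subgroup.normalizer (Subgroup.closure S : Set H) := by
  have h1 : ∀ s ∈ Subgroup.closure S, g * s * g⁻¹ ∈ Subgroup.closure S := by
    intro s hs
    have : Subgroup.closure S ≤ (Subgroup.closure S).comap (MulAut.conj g).toMonoidHom := by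
      rw [Subgroup.closure_le]
      intro s hs
      exact hS s hs
    exact this hs
  have h2 : ∀ (k : ℕ), ∀ s ∈ Subgroup.closure S, g ^ k * s * (g ^ k)⁻¹ ∈ Subgroup.closure S := by
    intro k
    induction k with
    | zero => intro s hs; simpa using hs
    | succ k ih =>
      intro s hs
      convert ih _ (h1 s hs) using 1
      rw [pow_succ]; group
  rw [Subgroup.mem_normalizer_iff]
  intro s
  refine ⟨h1 s, fun hs => ?_⟩
  have h3 := h2 n _ hs
  have h4 := mul_mem (mul_mem (inv_mem hg) h3) hg
  convert h4 using 1
  rw [pow_succ']; group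

theorem Rels.normal {x y z t : H} (h : Rels x y z t) (a b c : H)
    (hab : x = a * b) (hbc : y = b * c) (ht : t = a * b * a)
    (hgen : Subgroup.closure ({a, b, c} : Set H) = ⊤) :
    (Subgroup.closure (Set.range (w3 x y z))).Normal := by
  set K := Subgroup.closure (Set.range (w3 x y z)) with hK
  have m : ∀ j, w3 x y z j ∈ K := fun j => Subgroup.subset_closure ⟨j, rfl⟩
  have hx : x ∈ Subgroup.normalizer (K : Set H) := by
    refine mem_normalizer_of (n := 2) ?_ ?_
    · rintro _ ⟨i, rfl⟩
      exact conj_x x y z i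
    · convert m 0 using 1; simp [w3, pow_succ]
  have htt : t ∈ Subgroup.normalizer (K : Set H) := by
    refine mem_normalizer_of (n := 1) ?_ ?_
    · rintro _ ⟨i, rfl⟩
      exact h.conj_t i
    · convert m 0 using 1; simp [w3, pow_succ, h.r1]
  have hy : y ∈ Subgroup.normalizer (K : Set H) := by
    have := mul_mem (Subgroup.le_normalizer (m 1)) hx
    convert this using 1; simp [w3]
  have ha : a ∈ Subgroup.normalizer (K : Set H) := by
    convert mul_mem (inv_mem hx) htt using 1; rw [ht, hab]; group
  have hb : b ∈ Subgroup.normalizer (K : Set H) := by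
    convert mul_mem (inv_mem ha) hx using 1; rw [hab]; group
  have hc : c ∈ Subgroup.normalizer (K : Set H) := by
    convert mul_mem (inv_mem hb) hy using 1; rw [hbc]; group
  rw [← Subgroup.normalizer_eq_top_iff, eq_top_iff, ← hgen, Subgroup.closure_le]
  rintro g (rfl | rfl | rfl) <;> assumption

theorem coprod_braid {u v : H} (hu : u * (u * u) = 1) (hv : v * v = 1) :
    (u * u * v) * (v * (u * u)) * (u * u * v) = (v * (u * u)) * (u * u * v) * (v * (u * u)) ∧
    (v * (u * u)) * (u * v * u) * (v * (u * u)) = (u * v * u) * (v * (u * u)) * (u * v * u) ∧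
    (u * v * u) * (u * u * v) * (u * v * u) = (u * u * v) * (u * v * u) * (u * u * v) := by
  have hu' : ∀ g, u * (u * (u * g)) = g := fun g => by
    rw [← mul_assoc u u, ← mul_assoc (u * u), mul_assoc u u, hu, one_mul]
  have hv' : ∀ g, v * (v * g) = g := fun g => by rw [← mul_assoc, hv, one_mul]
  simp [mul_assoc, hu, hv, hu', hv']

end words

/-! ### Residual finiteness -/

theorem free_rf {α : Type} (g : FreeGroup α) (hg : g ≠ 1) :
    ∃ (Q : Type) (_ : Group Q) (_ : Finite Q) (φ : FreeGroup α →* Q), φ g ≠ 1 := by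
  classical
  -- partial left multiplications on a finite set extend to permutations
  have ext : ∀ (S : Finset (FreeGroup α)) (a : α), ∃ e : Equiv.Perm S,
      ∀ (x : S) (h : FreeGroup.of a * x.1 ∈ S), e x = ⟨FreeGroup.of a * x.1, h⟩ := by
    intro S a
    let p : S → Prop := fun x => FreeGroup.of a * x.1 ∈ S
    let q : S → Prop := fun x => (FreeGroup.of a)⁻¹ * x.1 ∈ S
    let e : {x // p x} ≃ {x // q x} :=
      { toFun := fun x => ⟨⟨FreeGroup.of a * x.1.1, x.2⟩, by
          simp only [q, inv_mul_cancel_left]; exact x.1.2⟩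
        invFun := fun x => ⟨⟨(FreeGroup.of a)⁻¹ * x.1.1, x.2⟩, by
          simp only [p, mul_inv_cancel_left]; exact x.1.2⟩
        left_inv := fun x => by ext; simp
        right_inv := fun x => by ext; simp }
    refine ⟨e.extendSubtype, fun x h => ?_⟩
    rw [Equiv.extendSubtype_apply_of_mem e x h]
    rfl
  choose E hE using ext
  -- every element can be traced inside some finite set
  have trace : ∀ L : List (α × Bool), ∃ S₀ : Finset (FreeGroup α), 1 ∈ S₀ ∧ FreeGroup.mk L ∈ S₀ ∧
      ∀ S : Finset (FreeGroup α), S₀ ⊆ S → ∀ h1 : 1 ∈ S, ∀ h2 : FreeGroup.mk L ∈ S,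
        FreeGroup.lift (E S) (FreeGroup.mk L) ⟨1, h1⟩ = ⟨FreeGroup.mk L, h2⟩ := by
    intro L
    induction L with
    | nil => exact ⟨{1}, by simp, by simp [← FreeGroup.one_eq_mk], fun S _ h1 h2 => by
        simp [← FreeGroup.one_eq_mk]⟩
    | cons l L ih =>
      obtain ⟨S₀, h1, h2, hS⟩ := ih
      have hl : FreeGroup.mk (l :: L) = FreeGroup.mk [l] * FreeGroup.mk L := by
        simp [FreeGroup.mul_mk]
      refine ⟨insert (FreeGroup.mk (l :: L)) S₀, by simp [h1], by simp, ?_⟩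
      intro S hSS h1' h2'
      have hLS : FreeGroup.mk L ∈ S := hSS (by simp [h2])
      have := hS S (fun x hx => hSS (by simp [hx])) h1' hLS
      have step : FreeGroup.lift (E S) (FreeGroup.mk [l]) ⟨FreeGroup.mk L, hLS⟩ =
          ⟨FreeGroup.mk (l :: L), h2'⟩ := by
        obtain ⟨a, b⟩ := l
        cases b
        · have e1 : FreeGroup.mk [(a, false)] = (FreeGroup.of a)⁻¹ := by
            simp [FreeGroup.of, FreeGroup.inv_mk, FreeGroup.invRev]
          rw [e1, map_inv, Equiv.Perm.inv_eq_iff_eq, FreeGroup.lift_apply_of, hE]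
          · apply Subtype.ext
            simp only [hl, e1, mul_inv_cancel_left]
          · simp only [hl, e1, mul_inv_cancel_left]; exact hLS
        · have e1 : FreeGroup.mk [(a, true)] = FreeGroup.of a := rfl
          rw [e1, FreeGroup.lift_apply_of, hE]
          · apply Subtype.ext
            simp only [hl, e1]
          · simp only; rw [← e1, ← hl]; exact h2'
      have hm : FreeGroup.lift (E S) (FreeGroup.mk (l :: L)) =
          FreeGroup.lift (E S) (FreeGroup.mk [l]) * FreeGroup.lift (E S) (FreeGroup.mk L) := by
        rw [hl, map_mul]
      rw [hm, Equiv.Perm.mul_apply, this, step]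
  obtain ⟨S, h1, h2, hS⟩ := trace g.toWord
  have := hS S subset_rfl h1 h2
  simp only [FreeGroup.mk_toWord] at this h2
  refine ⟨Equiv.Perm S, inferInstance, inferInstance, FreeGroup.lift (E S), fun h => hg ?_⟩
  rw [h] at this
  simpa using this.symm

open Classical in
/-- The truncated left multiplication action. -/
noncomputable def truncFun {A Q : Type} [Group A] [Group Q] (f : A →* Q) (S : Set Q) (a : A)
    (x : S) : S :=
  if h : ∀ a', f a' * x.1 ∈ S then ⟨f a * x.1, h a⟩ else x

theorem truncFun_mul {A Q : Type} [Group A] [Group Q] (f : A →* Q) (S : Set Q) (a b : A)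
    (x : S) : truncFun f S (a * b) x = truncFun f S a (truncFun f S b x) := by
  by_cases h : ∀ a', f a' * x.1 ∈ S
  · have h' : ∀ a', f a' * (f b * x.1) ∈ S := fun a' => by
      rw [← mul_assoc, ← map_mul]; exact h _
    have e : truncFun f S b x = ⟨f b * x.1, h b⟩ := by simp only [truncFun, dif_pos h]
    rw [e]
    simp only [truncFun, dif_pos h, dif_pos h', map_mul, mul_assoc]
  · have e : ∀ a, truncFun f S a x = x := fun a => by simp only [truncFun, dif_neg h]
    rw [e, e, e]

theorem truncFun_one {A Q : Type} [Group A] [Group Q] (f : A →* Q) (S : Set Q)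
    (x : S) : truncFun f S 1 x = x := by
  by_cases h : ∀ a', f a' * x.1 ∈ S
  · simp only [truncFun, dif_pos h]; ext; simp
  · simp only [truncFun, dif_neg h]

/-- The truncated action as a homomorphism. -/
noncomputable def trunc {A Q : Type} [Group A] [Group Q] (f : A →* Q) (S : Set Q) :
    A →* Equiv.Perm S :=
  letI : MulAction A S :=
    { smul := fun a x => truncFun f S a x
      one_smul := fun x => truncFun_one f S x
      mul_smul := fun a b x => truncFun_mul f S a b x }
  MulAction.toPermHom A S

theorem trunc_apply {A Q : Type} [Group A] [Group Q] (f : A →* Q) (S : Set Q) (a : A) (x : S)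
    (h : ∀ a', f a' * x.1 ∈ S) : trunc f S a x = ⟨f a * x.1, h a⟩ := by
  change truncFun f S a x = _
  simp only [truncFun, dif_pos h]

theorem coprod_rf {A B : Type} [Group A] [Group B] [Finite A] [Finite B]
    (g : Monoid.Coprod A B) (hg : g ≠ 1) :
    ∃ (Q : Type) (_ : Group Q) (_ : Finite Q) (φ : Monoid.Coprod A B →* Q), φ g ≠ 1 := by
  have trace : ∀ g : Monoid.Coprod A B, ∃ S₀ : Set (Monoid.Coprod A B), S₀.Finite ∧ 1 ∈ S₀ ∧ g ∈ S₀ ∧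
      ∀ S : Set (Monoid.Coprod A B), S₀ ⊆ S → ∀ h1 : 1 ∈ S, ∀ h2 : g ∈ S,
        Monoid.Coprod.lift (trunc Monoid.Coprod.inl S) (trunc Monoid.Coprod.inr S) g ⟨1, h1⟩
          = ⟨g, h2⟩ := by
    intro g
    induction g using Monoid.Coprod.induction_on' with
    | one => exact ⟨{1}, by simp, by simp, by simp, fun S _ h1 h2 => by simp⟩
    | inl_mul m x ih =>
      obtain ⟨S₀, hfin, h1, h2, hS⟩ := ih
      refine ⟨S₀ ∪ Set.range (fun a : A => Monoid.Coprod.inl a * x),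
        hfin.union (Set.finite_range _), Or.inl h1, Or.inr ⟨m, rfl⟩, ?_⟩
      intro S hSS h1' h2'
      rw [map_mul, Equiv.Perm.mul_apply,
        hS S (fun y hy => hSS (Or.inl hy)) h1' (hSS (Or.inl h2)), Monoid.Coprod.lift_apply_inl]
      exact trunc_apply _ _ _ _ (fun a' => hSS (Or.inr ⟨a', rfl⟩))
    | inr_mul m x ih =>
      obtain ⟨S₀, hfin, h1, h2, hS⟩ := ih
      refine ⟨S₀ ∪ Set.range (fun a : B => Monoid.Coprod.inr a * x),
        hfin.union (Set.finite_range _), Or.inl h1, Or.inr ⟨m, rfl⟩, ?_⟩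
      intro S hSS h1' h2'
      rw [map_mul, Equiv.Perm.mul_apply,
        hS S (fun y hy => hSS (Or.inl hy)) h1' (hSS (Or.inl h2)), Monoid.Coprod.lift_apply_inr]
      exact trunc_apply _ _ _ _ (fun a' => hSS (Or.inr ⟨a', rfl⟩))
  obtain ⟨S, hfin, h1, h2, hS⟩ := trace g
  have := hS S subset_rfl h1 h2
  have hfin' : Finite S := hfin
  refine ⟨Equiv.Perm S, inferInstance, inferInstance,
    Monoid.Coprod.lift (trunc Monoid.Coprod.inl S) (trunc Monoid.Coprod.inr S), fun h => hg ?_⟩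
  rw [h] at this
  simpa using this.symm

theorem free_centerless (g : FreeGroup (Fin 7)) (hg : g ≠ 1) :
    ∃ x : FreeGroup (Fin 7), g * x ≠ x * g := by
  have hW : g.toWord ≠ [] := by simpa using hg
  obtain ⟨w, L, hwL⟩ := List.exists_cons_of_ne_nil hW
  obtain ⟨a, ha⟩ : ∃ a : Fin 7, a ≠ w.1 := exists_ne _
  refine ⟨FreeGroup.of a, fun h => ?_⟩
  have h1 : (FreeGroup.of a * g).toWord = (a, true) :: g.toWord := by
    rw [FreeGroup.toWord_mul, FreeGroup.toWord_of, hwL]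
    apply FreeGroup.IsReduced.reduce_eq
    rw [List.singleton_append, FreeGroup.isReduced_cons_cons]
    refine ⟨fun e => absurd e ha, ?_⟩
    rw [← hwL]
    exact FreeGroup.isReduced_toWord
  have h2 := FreeGroup.toWord_mul_sublist g (FreeGroup.of a)
  rw [h, h1, FreeGroup.toWord_of] at h2
  have h3 := h2.eq_of_length (by simp)
  rw [hwL] at h3
  simp at h3
  exact ha (by rw [← h3.1])

theorem rf_extension {G : Type} [Group G] (N : Subgroup G) [N.Normal]
    (e : N ≃* FreeGroup (Fin 7)) {A B : Type} [Group A] [Group B] [Finite A] [Finite B]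
    (e' : (G ⧸ N) ≃* Monoid.Coprod A B) : ResiduallyFinite G := by
  intro g hg
  by_cases hgN : g ∈ N
  · -- `g` acts nontrivially on the finite set of homomorphisms from `N` to a finite group
    let n : N := ⟨g, hgN⟩
    have hn : e n ≠ 1 := by
      intro h
      apply hg
      have : n = 1 := by simpa using h
      exact congrArg Subtype.val this
    obtain ⟨x, hx⟩ := free_centerless (e n) hn
    obtain ⟨Q, _, _, φ, hφ⟩ := free_rf (e n * x * (e n)⁻¹ * x⁻¹) (by
      intro h
      apply hx
      rw [mul_inv_eq_one, mul_inv_eq_iff_eq_mul] at h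
      exact h)
    haveI : Finite (N →* Q) := by
      refine Finite.of_injective (β := Fin 7 → Q)
        (fun f i => f (e.symm (FreeGroup.of i))) ?_
      intro f f' hff
      have : f.comp e.symm.toMonoidHom = f'.comp e.symm.toMonoidHom := by
        ext i
        exact congrFun hff i
      ext y
      have := DFunLike.congr_fun this (e y)
      simpa using this
    letI : MulAction G (N →* Q) :=
      { smul := fun g f => f.comp (MulAut.conjNormal g⁻¹ : MulAut N).toMonoidHom
        one_smul := fun f => by
          change f.comp (MulAut.conjNormal (1 : G)⁻¹ : MulAut N).toMonoidHom = f
          ext y; simp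
        mul_smul := fun g h f => by
          change f.comp (MulAut.conjNormal (g * h)⁻¹ : MulAut N).toMonoidHom =
            (f.comp (MulAut.conjNormal h⁻¹ : MulAut N).toMonoidHom).comp
              (MulAut.conjNormal g⁻¹ : MulAut N).toMonoidHom
          ext y; simp }
    refine ⟨Equiv.Perm (N →* Q), inferInstance, inferInstance, MulAction.toPermHom G _, ?_⟩
    intro h
    have h' : MulAction.toPermHom G (N →* Q) g⁻¹ = 1 := by rw [map_inv, h, inv_one]
    have h1 := DFunLike.congr_fun (DFunLike.congr_fun h' (φ.comp e.toMonoidHom)) (e.symm x)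
    have h2 : φ (e (MulAut.conjNormal g⁻¹⁻¹ (e.symm x))) = φ (e (e.symm x)) := h1
    have h3 : MulAut.conjNormal g⁻¹⁻¹ (e.symm x) = n * e.symm x * n⁻¹ := by
      ext; simp [n]
    rw [h3] at h2
    simp only [map_mul, map_inv, MulEquiv.apply_symm_apply] at h2
    apply hφ
    simp [h2]
  · obtain ⟨Q, i, j, φ, hφ⟩ := coprod_rf (e' (QuotientGroup.mk' N g)) (by
      simpa using hgN)
    exact ⟨Q, i, j, (φ.comp e'.toMonoidHom).comp (QuotientGroup.mk' N), hφ⟩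

/-! ### Assembly -/

/-- Homomorphisms out of a cyclic group. -/
theorem exists_zmod_hom {H : Type} [Group H] (n : ℕ) (g : H) (hg : g ^ n = 1) :
    ∃ f : Multiplicative (ZMod n) →* H, f (Multiplicative.ofAdd 1) = g := by
  let f₀ : ℤ →+ Additive H := zmultiplesHom (Additive H) (Additive.ofMul g)
  have hf : f₀ n = 0 := by
    change (n : ℤ) • Additive.ofMul g = 0
    rw [natCast_zsmul, ← ofMul_pow, hg]; rfl
  refine ⟨AddMonoidHom.toMultiplicativeLeft (ZMod.lift n ⟨f₀, hf⟩), ?_⟩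
  have h1 : ZMod.lift n ⟨f₀, hf⟩ ((1 : ℤ) : ZMod n) = f₀ 1 := ZMod.lift_coe n ⟨f₀, hf⟩ 1
  have h2 : f₀ 1 = Additive.ofMul g := by simp [f₀]
  rw [h2] at h1
  simpa using congrArg Additive.toMul h1

theorem zmod_hom_ext {H : Type} [Group H] (n : ℕ) (f f' : Multiplicative (ZMod n) →* H)
    (h : f (Multiplicative.ofAdd 1) = f' (Multiplicative.ofAdd 1)) : f = f' := by
  refine MonoidHom.ext fun y => ?_
  obtain ⟨k, hk⟩ := ZMod.intCast_surjective (Multiplicative.toAdd y)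
  have : y = (Multiplicative.ofAdd (1 : ZMod n)) ^ k := by
    apply Multiplicative.toAdd.injective
    simp [← hk]
  rw [this, map_zpow, map_zpow, h]

theorem altWord_three {V : Type} (a b : V) : altWord a b 3 =
    FreeGroup.of a * FreeGroup.of b * FreeGroup.of a := by
  simp [altWord, List.range_succ, mul_assoc]

theorem exists_artin_hom {H : Type} [Group H] (a b c : H) (h1 : a * b * a = b * a * b)
    (h2 : b * c * b = c * b * c) (h3 : c * a * c = a * c * a) :
    ∃ f : Artin3 3 3 3 →* H, f (PresentedGroup.of 0) = a ∧ f (PresentedGroup.of 1) = b ∧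
      f (PresentedGroup.of 2) = c := by
  have : ∀ r ∈ artinRels3 3 3 3, FreeGroup.lift ![a, b, c] r = 1 := by
    rintro r (rfl | rfl | rfl) <;> rw [map_mul, map_inv, mul_inv_eq_one] <;>
      simp [altWord_three, h1, h2, h3]
  refine ⟨PresentedGroup.toGroup this, ?_, ?_, ?_⟩ <;> simp

theorem artin_rel (i j : Fin 3)
    (h : altWord i j 3 * (altWord j i 3)⁻¹ ∈ artinRels3 3 3 3) :
    (PresentedGroup.of i * PresentedGroup.of j * PresentedGroup.of i : Artin3 3 3 3) =
      PresentedGroup.of j * PresentedGroup.of i * PresentedGroup.of j := by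
  have := PresentedGroup.one_of_mem h
  rw [map_mul, map_inv, mul_inv_eq_one, altWord_three, altWord_three] at this
  simpa [PresentedGroup.of] using this

/-- The free product. -/
abbrev C : Type := Monoid.Coprod (Multiplicative (ZMod 3)) (Multiplicative (ZMod 2))

theorem main_aux : ∃ (N : Subgroup (Artin3 3 3 3)) (_ : N.Normal),
      Nonempty (N ≃* FreeGroup (Fin 7)) ∧
      Nonempty ((Artin3 3 3 3 ⧸ N) ≃*
        Monoid.Coprod (Multiplicative (ZMod 3)) (Multiplicative (ZMod 2))) := by
  obtain ⟨a, ha⟩ : ∃ a : Artin3 3 3 3, a = PresentedGroup.of 0 := ⟨_, rfl⟩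
  obtain ⟨b, hb⟩ : ∃ b : Artin3 3 3 3, b = PresentedGroup.of 1 := ⟨_, rfl⟩
  obtain ⟨c, hc⟩ : ∃ c : Artin3 3 3 3, c = PresentedGroup.of 2 := ⟨_, rfl⟩
  have hgen : Subgroup.closure ({a, b, c} : Set (Artin3 3 3 3)) = ⊤ := by
    rw [eq_top_iff, ← PresentedGroup.closure_range_of, Subgroup.closure_le]
    rintro _ ⟨i, rfl⟩
    apply Subgroup.subset_closure
    fin_cases i <;> simp [ha, hb, hc]
  have b1 : a * b * a = b * a * b := by
    rw [ha, hb]; exact artin_rel 0 1 (by simp [artinRels3])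
  have b2 : b * c * b = c * b * c := by
    rw [hb, hc]; exact artin_rel 1 2 (by simp [artinRels3])
  have b3 : c * a * c = a * c * a := by
    rw [ha, hc]; exact artin_rel 2 0 (by simp [artinRels3])
  have R := rels_of_braid b1 b2 b3
  have hN := R.normal a b c rfl rfl rfl hgen
  set N := Subgroup.closure (Set.range (w3 (a * b) (b * c) (c * a))) with hNdef
  refine ⟨N, hN, ?_, ?_⟩
  · -- freeness
    obtain ⟨P, _, iA, iB, hAB, hinj⟩ := exists_amalgam _ _ inj3 inj4
    have n3 : ∀ i, iA (w3 (FreeGroup.of (0 : Fin 3)) (FreeGroup.of 1) (FreeGroup.of 2) i) =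
        w3 (iA (FreeGroup.of 0)) (iA (FreeGroup.of 1)) (iA (FreeGroup.of 2)) i := by
      intro i; fin_cases i <;> simp [w3]
    have n4 : ∀ i, iB (w4 (FreeGroup.of (0 : Fin 4)) (FreeGroup.of 1) (FreeGroup.of 2)
          (FreeGroup.of 3) i) =
        w4 (iB (FreeGroup.of 0)) (iB (FreeGroup.of 1)) (iB (FreeGroup.of 2))
          (iB (FreeGroup.of 3)) i := by
      intro i; fin_cases i <;> simp [w4]
    have RP : Rels (iA (FreeGroup.of 0)) (iA (FreeGroup.of 1)) (iA (FreeGroup.of 2))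
        (iB (FreeGroup.of 0)) := by
      refine Rels.of_eq (p := iB (FreeGroup.of 1)) (q := iB (FreeGroup.of 2))
        (r := iB (FreeGroup.of 3)) fun i => ?_
      rw [← n3, ← n4]
      simpa using hAB (FreeGroup.of i)
    obtain ⟨F, Fa, Fb, Fc⟩ := exists_artin_hom _ _ _ RP.braid1 RP.braid2 RP.braid3
    rw [← ha] at Fa
    rw [← hb] at Fb
    rw [← hc] at Fc
    have Fx : F (a * b) = iA (FreeGroup.of 0) := by rw [map_mul, Fa, Fb]; group
    have Fy : F (b * c) = iA (FreeGroup.of 1) := by rw [map_mul, Fb, Fc]; group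
    have Fz : F (c * a) = iA (FreeGroup.of 2) := by rw [map_mul, Fc, Fa]; exact RP.z_eq
    let ψ : FreeGroup (Fin 7) →* Artin3 3 3 3 :=
      FreeGroup.lift (w3 (a * b) (b * c) (c * a))
    have hcomp : F.comp ψ = iA.comp
        (FreeGroup.lift (w3 (FreeGroup.of (0 : Fin 3)) (FreeGroup.of 1) (FreeGroup.of 2))) := by
      ext i
      simp only [ψ, MonoidHom.comp_apply, FreeGroup.lift_apply_of]
      rw [n3, ← Fx, ← Fy, ← Fz]
      fin_cases i <;> simp [w3]
    have hψ : Function.Injective ψ := by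
      intro g g' h
      apply hinj
      have h1 := DFunLike.congr_fun hcomp g
      have h2 := DFunLike.congr_fun hcomp g'
      simp only [MonoidHom.comp_apply] at h1 h2
      simp only
      rw [← h1, ← h2, h]
    have hr : ψ.range = N := by
      rw [FreeGroup.range_lift_eq_closure]
    rw [← hr]
    exact ⟨(MonoidHom.ofInjective hψ).symm⟩
  · -- the quotient
    obtain ⟨u, hu⟩ : ∃ u : C, u = Monoid.Coprod.inl (Multiplicative.ofAdd 1) := ⟨_, rfl⟩
    obtain ⟨v, hv⟩ : ∃ v : C, v = Monoid.Coprod.inr (Multiplicative.ofAdd 1) := ⟨_, rfl⟩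
    have hu3 : u * (u * u) = 1 := by
      rw [hu, ← map_mul, ← map_mul]
      exact map_one _
    have hv2 : v * v = 1 := by
      rw [hv, ← map_mul]
      exact map_one _
    obtain ⟨c1, c2, c3⟩ := coprod_braid hu3 hv2
    obtain ⟨F, Fa, Fb, Fc⟩ := exists_artin_hom _ _ _ c1 c2 c3
    rw [← ha] at Fa
    rw [← hb] at Fb
    rw [← hc] at Fc
    have hu' : ∀ g, u * (u * (u * g)) = g := fun g => by
      rw [← mul_assoc u u, ← mul_assoc (u * u), mul_assoc u u, hu3, one_mul]
    have hv' : ∀ g, v * (v * g) = g := fun g => by rw [← mul_assoc, hv2, one_mul]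
    have Fx : F (a * b) = u := by rw [map_mul, Fa, Fb]; simp [mul_assoc, hu3, hv2, hu', hv']
    have Fy : F (b * c) = u := by rw [map_mul, Fb, Fc]; simp [mul_assoc, hu3, hv2, hu', hv']
    have Fz : F (c * a) = u := by rw [map_mul, Fc, Fa]; simp [mul_assoc, hu3, hv2, hu', hv']
    have Ft : F (a * b * a) = v := by
      rw [map_mul, Fx, Fa]; simp [mul_assoc, hu']
    have w3map : ∀ x y z : Artin3 3 3 3, ∀ i, F (w3 x y z i) = w3 (F x) (F y) (F z) i := by
      intro x y z i
      fin_cases i <;> simp [w3]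
    have hker : N ≤ F.ker := by
      rw [hNdef, Subgroup.closure_le]
      rintro _ ⟨i, rfl⟩
      rw [SetLike.mem_coe, MonoidHom.mem_ker]
      have : F (w3 (a * b) (b * c) (c * a) i) = w3 u u u i := by
        rw [w3map, Fx, Fy, Fz]
      rw [this]
      fin_cases i <;> simp [w3, mul_assoc, hu3]
    have m : ∀ i, w3 (a * b) (b * c) (c * a) i ∈ N := fun i => Subgroup.subset_closure ⟨i, rfl⟩
    have q3 : (QuotientGroup.mk' N (a * b)) ^ 3 = 1 := by
      rw [← map_pow]
      refine (QuotientGroup.eq_one_iff _).2 ?_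
      convert m 0 using 1
      simp [w3, pow_succ]
    have q2 : (QuotientGroup.mk' N (a * b * a)) ^ 2 = 1 := by
      rw [← map_pow]
      refine (QuotientGroup.eq_one_iff _).2 ?_
      convert m 0 using 1
      rw [pow_two, R.r1]; rfl
    obtain ⟨f3, hf3⟩ := exists_zmod_hom 3 _ q3
    obtain ⟨f2, hf2⟩ := exists_zmod_hom 2 _ q2
    let Φ : Artin3 3 3 3 ⧸ N →* C := QuotientGroup.lift N F hker
    let Ψ : C →* Artin3 3 3 3 ⧸ N := Monoid.Coprod.lift f3 f2
    have Ψu : Ψ u = QuotientGroup.mk' N (a * b) := by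
      rw [hu, ← hf3]; exact Monoid.Coprod.lift_apply_inl _ _ _
    have Ψv : Ψ v = QuotientGroup.mk' N (a * b * a) := by
      rw [hv, ← hf2]; exact Monoid.Coprod.lift_apply_inr _ _ _
    have Φm : ∀ g, Φ (QuotientGroup.mk' N g) = F g := fun g => rfl
    have hx1 : QuotientGroup.mk' N (b * c) = QuotientGroup.mk' N (a * b) := by
      rw [← mul_inv_eq_one, ← map_inv, ← map_mul]
      exact (QuotientGroup.eq_one_iff _).2 (m 1)
    have Ga : Ψ (F a) = QuotientGroup.mk' N a := by
      have : F a = u⁻¹ * v := by rw [← Fx, ← Ft, ← map_inv, ← map_mul]; congr 1; group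
      rw [this, map_mul, map_inv, Ψu, Ψv, ← map_inv, ← map_mul]; congr 1; group
    have Gb : Ψ (F b) = QuotientGroup.mk' N b := by
      have : F b = (F a)⁻¹ * u := by rw [← Fx, ← map_inv, ← map_mul]; congr 1; group
      rw [this, map_mul, map_inv, Ψu, Ga, ← map_inv, ← map_mul]; congr 1; group
    have Gc : Ψ (F c) = QuotientGroup.mk' N c := by
      have : F c = (F b)⁻¹ * u := by rw [← Fy, ← map_inv, ← map_mul]; congr 1; group
      rw [this, map_mul, map_inv, Ψu, Gb, ← hx1, ← map_inv, ← map_mul]; congr 1; group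
    refine ⟨MonoidHom.toMulEquiv Φ Ψ ?_ ?_⟩
    · apply QuotientGroup.monoidHom_ext
      apply PresentedGroup.ext
      intro i
      fin_cases i
      · change Ψ (F (PresentedGroup.of 0)) = QuotientGroup.mk' N (PresentedGroup.of 0)
        rw [← ha]; exact Ga
      · change Ψ (F (PresentedGroup.of 1)) = QuotientGroup.mk' N (PresentedGroup.of 1)
        rw [← hb]; exact Gb
      · change Ψ (F (PresentedGroup.of 2)) = QuotientGroup.mk' N (PresentedGroup.of 2)
        rw [← hc]; exact Gc
    · apply Monoid.Coprod.hom_ext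
      · apply zmod_hom_ext
        change Φ (Ψ (Monoid.Coprod.inl (Multiplicative.ofAdd 1))) = _
        rw [← hu, Ψu, Φm, Fx, hu]; rfl
      · apply zmod_hom_ext
        change Φ (Ψ (Monoid.Coprod.inr (Multiplicative.ofAdd 1))) = _
        rw [← hv, Ψv, Φm, Ft, hv]; rfl

end Artin333

theorem artin333_free_by_virtually_free_and_residuallyFinite :
    (∃ (N : Subgroup (Artin3 3 3 3)) (_ : N.Normal),
      Nonempty (N ≃* FreeGroup (Fin 7)) ∧
      Nonempty ((Artin3 3 3 3 ⧸ N) ≃*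
        Monoid.Coprod (Multiplicative (ZMod 3)) (Multiplicative (ZMod 2)))) ∧
    ResiduallyFinite (Artin3 3 3 3) := by
  obtain ⟨N, hN, ⟨e⟩, ⟨e'⟩⟩ := Artin333.main_aux
  haveI : Finite (Multiplicative (ZMod 3)) := inferInstanceAs (Finite (ZMod 3))
  haveI : Finite (Multiplicative (ZMod 2)) := inferInstanceAs (Finite (ZMod 2))
  exact ⟨⟨N, hN, ⟨e⟩, ⟨e'⟩⟩, Artin333.rf_extension N e e'⟩
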